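/- Let f : ℝ^n → ℝ be differentiable at W and scale-invariant, i.e. f(λ • W) = f(W) for every nonzero scalar λ. Then for any step size η ∈ ℝ, the gradient update W' = W + η • ∇f(W) satisfies ‖W'‖² = ‖W‖² + η² · ‖∇f(W)‖². -/

import Mathlib

/-- The gradient of a function that is invariant under nonzero rescalings of `W` is orthogonal
to `W`. -/
theorem inner_gradient_eq_zero_of_scale_invariant
    {E : Type*} [NormedAddCommGroup E] [InnerProductSpace ℝ E] [CompleteSpace E]
    {f : E → ℝ} {W : E} (hdiff : DifferentiableAt ℝ f W)
    (hscale : ∀ c : ℝ, c ≠ 0 → f (c • W) = f W) :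
    inner ℝ W (gradient f W) = 0 := by
  have hline : HasDerivAt (fun c : ℝ => c • W) W 1 := by
    simpa using (hasDerivAt_id (1 : ℝ)).smul_const W
  have hcomp : HasDerivAt (fun c : ℝ => f (c • W)) (fderiv ℝ f W W) 1 :=
    HasFDerivAt.comp_hasDerivAt (1 : ℝ) (by simpa using hdiff.hasFDerivAt) hline
  have hconst : HasDerivAt (fun c : ℝ => f (c • W)) 0 1 :=
    (hasDerivAt_const (1 : ℝ) (f W)).congr_of_eventuallyEq <| by
      filter_upwards [eventually_ne_nhds one_ne_zero] with c hc using hscale c hc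
  rw [real_inner_comm, gradient, InnerProductSpace.toDual_symm_apply]
  exact hcomp.unique hconst

/-- **One-step norm growth (Eq. (5), Pythagorean form).** If `f : ℝⁿ → ℝ` is
differentiable at `W` and scale-invariant (`f (λ • W) = f W` for every nonzero `λ`),
then the gradient update `W' = W + η • ∇f(W)` satisfies
`‖W'‖² = ‖W‖² + η² * ‖∇f(W)‖²`. -/
theorem norm_sq_update_of_scale_invariant
    {n : ℕ} (f : EuclideanSpace ℝ (Fin n) → ℝ) (W : EuclideanSpace ℝ (Fin n))
    (hdiff : DifferentiableAt ℝ f W)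
    (hscale : ∀ lam : ℝ, lam ≠ 0 → f (lam • W) = f W)
    (η : ℝ) :
    ‖W + η • gradient f W‖ ^ 2 = ‖W‖ ^ 2 + η ^ 2 * ‖gradient f W‖ ^ 2 := by
  rw [norm_add_sq_real, inner_smul_right,
    inner_gradient_eq_zero_of_scale_invariant hdiff hscale, norm_smul, mul_pow,
    Real.norm_eq_abs, sq_abs]
  ring
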